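/- For an ensemble σ = ∑_k λ_k σ_k, a channel Γ* = Γ₁* ∘ Γ₂* with Γ₁* a pinching by a projection valued measure {E_i}, the mutual entropy satisfies the two-sided bound: ∑_i[−Tr(Γ₂*σ E_i) log Tr(Γ₂*σ E_i) + ∑_k λ_k Tr(Γ₂*σ_k E_i) log Tr(Γ₂*σ_k E_i)] ≤ ∑_k λ_k S(Γ*σ_k, Γ*σ) ≤ ∑_k λ_k S(σ_k, σ). -/

import Mathlib

open Matrix Kronecker
open scoped BigOperators ComplexOrder

variable {n m : Type*}

/-- Functional-calculus logarithm of a Hermitian matrix, restricted to its support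
(zero eigenvalues are sent to zero). Returns 0 for non-Hermitian matrices. -/
noncomputable def matLog [Fintype n] [DecidableEq n] (A : Matrix n n ℂ) : Matrix n n ℂ :=
  if h : A.IsHermitian then
    (h.eigenvectorUnitary : Matrix n n ℂ) *
      Matrix.diagonal (fun i => (Real.log (h.eigenvalues i) : ℂ)) *
      (star (h.eigenvectorUnitary : Matrix n n ℂ))
  else 0

/-- Extended Umegaki relative entropy `S(A,B) = Tr[A(log A − log B)]` (real part). -/
noncomputable def relEnt [Fintype n] [DecidableEq n] (A B : Matrix n n ℂ) : ℝ :=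
  ((A * (matLog A - matLog B)).trace).re

/-- von Neumann entropy `S(ρ) = −Tr[ρ log ρ]`. -/
noncomputable def vnEnt [Fintype n] [DecidableEq n] (ρ : Matrix n n ℂ) : ℝ :=
  -((ρ * matLog ρ).trace).re

/-- A density matrix: positive semidefinite with unit trace. -/
def IsDensity [Fintype n] [DecidableEq n] (ρ : Matrix n n ℂ) : Prop :=
  ρ.PosSemidef ∧ ρ.trace = 1

/-- Completely positive trace-preserving map, via a Kraus representation. -/
def IsCPTP [Fintype n] [DecidableEq n] [Fintype m] [DecidableEq m]
    (Λ : Matrix n n ℂ → Matrix m m ℂ) : Prop :=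
  ∃ (ι : Type) (_ : Fintype ι) (K : ι → Matrix m n ℂ),
    (∀ A, Λ A = ∑ i, K i * A * (K i)ᴴ) ∧ (∑ i, (K i)ᴴ * K i = 1)

/-- An orthogonal resolution of the identity (projection valued measure). -/
def OrthRes [Fintype n] [DecidableEq n] {ι : Type*} [Fintype ι]
    (E : ι → Matrix n n ℂ) : Prop :=
  (∀ i, (E i).IsHermitian) ∧ (∀ i, E i * E i = E i) ∧
  (∀ i j, i ≠ j → E i * E j = 0) ∧ (∑ i, E i = 1)

/-- A Schatten decomposition of ρ: rank-one orthogonal spectral projections. -/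
def SchattenDecomp [Fintype n] [DecidableEq n]
    (ρ : Matrix n n ℂ) (lam : n → ℝ) (E : n → Matrix n n ℂ) : Prop :=
  (∀ k, 0 ≤ lam k) ∧ OrthRes E ∧ (∀ k, (E k).trace = 1) ∧
  ρ = ∑ k, (lam k : ℂ) • E k

/-- Ohya's quantum mutual entropy `I(ρ;Λ*)`. -/
noncomputable def mutEnt [Fintype n] [DecidableEq n] [Fintype m] [DecidableEq m]
    (ρ : Matrix n n ℂ) (Λ : Matrix n n ℂ → Matrix m m ℂ) : ℝ :=
  sSup {x : ℝ | ∃ lam E, SchattenDecomp ρ lam E ∧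
    x = ∑ k, lam k * relEnt (Λ (E k)) (Λ ρ)}

lemma hasDerivAt_mul_log_add_mul {w a b s : ℝ} (ha : 0 ≤ a) (h : w ≠ 0 → a ≠ 0 → 0 < b)
    (hs : 0 ≤ s) :
    HasDerivAt (fun s => w * a * Real.log (b + s * a)) (w * (a ^ 2 / (b + s * a))) s := by
  by_cases hw : w = 0
  · simpa [hw] using hasDerivAt_const s (0 : ℝ)
  by_cases ha0 : a = 0
  · simpa [ha0] using hasDerivAt_const s (0 : ℝ)
  have hb := h hw ha0
  have hpos : 0 < b + s * a := by positivity
  have h1 : HasDerivAt (fun s : ℝ => b + s * a) a s := by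
    simpa using ((hasDerivAt_id s).mul_const a).const_add b
  exact ((h1.log hpos.ne').const_mul (w * a)).congr_deriv (by ring)

open Filter Topology in
lemma tendsto_mul_log_add_mul_sub {w a b : ℝ} (ha : 0 ≤ a) (hb : 0 ≤ b) :
    Tendsto (fun s => w * a * Real.log (b + s * a) - w * a * Real.log s) atTop
      (𝓝 (w * a * Real.log a)) := by
  by_cases ha0 : a = 0
  · simp [ha0]
  have hapos : 0 < a := lt_of_le_of_ne ha (Ne.symm ha0)
  have h1 : Tendsto (fun s : ℝ => b / s + a) atTop (𝓝 a) := by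
    simpa using (tendsto_const_nhds.div_atTop tendsto_id).add_const a
  refine ((h1.log ha0).const_mul (w * a)).congr' ?_
  filter_upwards [eventually_gt_atTop 0] with s hs
  have : b + s * a = s * (b / s + a) := by field_simp
  rw [this, Real.log_mul hs.ne' (by positivity)]
  ring

/-- Comparing the resolvent sums `∑ w a² / (b + s a)` for all `s > 0` compares the classical
relative entropies, because the former are the derivatives of `∑ w a log (b + s a)`. -/
lemma sum_mul_log_sub_le_of_resolvent_le {P Q : Type*} [Fintype P] [Fintype Q]
    (w a b : P → ℝ) (w' a' b' : Q → ℝ)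
    (ha : ∀ p, 0 ≤ a p) (hb : ∀ p, 0 ≤ b p) (h : ∀ p, w p ≠ 0 → a p ≠ 0 → 0 < b p)
    (ha' : ∀ p, 0 ≤ a' p) (hb' : ∀ p, 0 ≤ b' p) (h' : ∀ p, w' p ≠ 0 → a' p ≠ 0 → 0 < b' p)
    (htot : ∑ p, w p * a p = ∑ p, w' p * a' p)
    (hle : ∀ s, 0 < s → ∑ p, w' p * (a' p ^ 2 / (b' p + s * a' p)) ≤
      ∑ p, w p * (a p ^ 2 / (b p + s * a p))) :
    ∑ p, w' p * a' p * (Real.log (a' p) - Real.log (b' p)) ≤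
      ∑ p, w p * a p * (Real.log (a p) - Real.log (b p)) := by
  set G : ℝ → ℝ := fun s => ∑ p, w p * a p * Real.log (b p + s * a p) -
    ∑ p, w' p * a' p * Real.log (b' p + s * a' p) with hG
  have hderiv : ∀ s, 0 ≤ s → HasDerivAt G (∑ p, w p * (a p ^ 2 / (b p + s * a p)) -
      ∑ p, w' p * (a' p ^ 2 / (b' p + s * a' p))) s := fun s hs =>
    (HasDerivAt.fun_sum fun p _ => hasDerivAt_mul_log_add_mul (ha p) (h p) hs).sub
      (HasDerivAt.fun_sum fun p _ => hasDerivAt_mul_log_add_mul (ha' p) (h' p) hs)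
  have hmono : MonotoneOn G (Set.Ici 0) := by
    refine monotoneOn_of_deriv_nonneg (convex_Ici 0)
      (fun s hs => (hderiv s hs).continuousAt.continuousWithinAt)
      (fun s hs => (hderiv s (interior_subset hs)).differentiableAt.differentiableWithinAt) ?_
    intro s hs
    rw [(hderiv s (interior_subset hs)).deriv]
    rw [interior_Ici] at hs
    exact sub_nonneg.2 (hle s hs)
  have hlim : Filter.Tendsto G Filter.atTop (nhds (∑ p, w p * a p * Real.log (a p) -
      ∑ p, w' p * a' p * Real.log (a' p))) := by
    refine ((tendsto_finsetSum _ fun p _ =>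
      tendsto_mul_log_add_mul_sub (w := w p) (ha p) (hb p)).sub
      (tendsto_finsetSum _ fun p _ =>
        tendsto_mul_log_add_mul_sub (w := w' p) (ha' p) (hb' p))).congr fun s => ?_
    simp only [hG, Finset.sum_sub_distrib, ← Finset.sum_mul, htot]
    ring
  have h0 : G 0 ≤ _ := ge_of_tendsto hlim <| (Filter.eventually_ge_atTop 0).mono
    fun s hs => hmono Set.self_mem_Ici hs hs
  simp only [hG, zero_mul, add_zero] at h0
  simp only [mul_sub, Finset.sum_sub_distrib]
  linarith

/-- The matrix of overlaps between the eigenvectors of `B` (rows) and of `A` (columns). -/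
noncomputable def eigenOverlap [Fintype n] [DecidableEq n] {A B : Matrix n n ℂ}
    (hA : A.IsHermitian) (hB : B.IsHermitian) : Matrix n n ℂ :=
  star (hB.eigenvectorUnitary : Matrix n n ℂ) * (hA.eigenvectorUnitary : Matrix n n ℂ)

lemma isHermitian_eq_conj [Fintype n] [DecidableEq n] {A : Matrix n n ℂ} (hA : A.IsHermitian) :
    A = (hA.eigenvectorUnitary : Matrix n n ℂ) *
      Matrix.diagonal (fun i => (hA.eigenvalues i : ℂ)) *
      star (hA.eigenvectorUnitary : Matrix n n ℂ) := by
  have := hA.spectral_theorem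
  rw [Unitary.conjStarAlgAut_apply] at this
  exact this

lemma re_trace_conjTranspose_mul_diagonal_mul [Fintype n] [DecidableEq n] (X : Matrix n n ℂ)
    (d : n → ℝ) :
    ((Xᴴ * Matrix.diagonal (fun i => (d i : ℂ)) * X).trace).re =
      ∑ p : n × n, d p.1 * Complex.normSq (X p.1 p.2) := by
  rw [Fintype.sum_prod_type, Finset.sum_comm, Matrix.trace, Complex.re_sum]
  refine Finset.sum_congr rfl fun i _ => ?_
  rw [Matrix.diag_apply, Matrix.mul_apply, Complex.re_sum]
  refine Finset.sum_congr rfl fun j _ => ?_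
  simp only [Matrix.mul_diagonal, Matrix.conjTranspose_apply, Complex.normSq_apply,
    RCLike.star_def, Complex.mul_re, Complex.mul_im, Complex.conj_re, Complex.conj_im,
    Complex.ofReal_re, Complex.ofReal_im]
  ring

lemma sum_normSq_mul_eq_trace [Fintype n] [DecidableEq n] (W : Matrix n n ℂ) (c d : n → ℝ) :
    ((Wᴴ * Matrix.diagonal (fun j => (d j : ℂ)) * W *
      Matrix.diagonal (fun i => (c i : ℂ))).trace).re =
      ∑ p : n × n, Complex.normSq (W p.1 p.2) * c p.2 * d p.1 := by
  rw [Fintype.sum_prod_type, Finset.sum_comm, Matrix.trace, Complex.re_sum]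
  refine Finset.sum_congr rfl fun i _ => ?_
  rw [Matrix.diag_apply, Matrix.mul_diagonal, Matrix.mul_apply, Finset.sum_mul, Complex.re_sum]
  refine Finset.sum_congr rfl fun j _ => ?_
  simp only [Matrix.mul_diagonal, Matrix.conjTranspose_apply, Complex.normSq_apply,
    RCLike.star_def, Complex.mul_re, Complex.mul_im, Complex.conj_re, Complex.conj_im,
    Complex.ofReal_re, Complex.ofReal_im]
  ring

lemma re_trace_conj_mul_conj [Fintype n] [DecidableEq n] {A B : Matrix n n ℂ}
    (hA : A.IsHermitian) (hB : B.IsHermitian) (c d : n → ℝ) :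
    (((hA.eigenvectorUnitary : Matrix n n ℂ) * Matrix.diagonal (fun i => (c i : ℂ)) *
      star (hA.eigenvectorUnitary : Matrix n n ℂ) *
      ((hB.eigenvectorUnitary : Matrix n n ℂ) * Matrix.diagonal (fun i => (d i : ℂ)) *
        star (hB.eigenvectorUnitary : Matrix n n ℂ))).trace).re =
      ∑ p : n × n, Complex.normSq (eigenOverlap hA hB p.1 p.2) * c p.2 * d p.1 := by
  rw [← sum_normSq_mul_eq_trace, eigenOverlap]
  simp only [Matrix.star_eq_conjTranspose, Matrix.conjTranspose_mul,
    Matrix.conjTranspose_conjTranspose, Matrix.mul_assoc]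
  rw [Matrix.trace_mul_comm]
  conv_rhs => rw [Matrix.trace_mul_comm]
  simp only [Matrix.mul_assoc]
  conv_lhs => rw [Matrix.trace_mul_comm]
  simp only [Matrix.mul_assoc]
  rw [Matrix.trace_mul_comm]
  simp only [Matrix.mul_assoc]

lemma conjTranspose_mul_eigenOverlap_self [Fintype n] [DecidableEq n] {A B : Matrix n n ℂ}
    (hA : A.IsHermitian) (hB : B.IsHermitian) :
    (eigenOverlap hA hB)ᴴ * eigenOverlap hA hB = 1 :=
  Unitary.star_mul_self_of_mem
    (star hB.eigenvectorUnitary * hA.eigenvectorUnitary : Matrix.unitaryGroup n ℂ).2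

lemma sum_normSq_eigenOverlap_mul [Fintype n] [DecidableEq n] {A B : Matrix n n ℂ}
    (hA : A.IsHermitian) (hB : B.IsHermitian) (c : n → ℝ) :
    ∑ p : n × n, Complex.normSq (eigenOverlap hA hB p.1 p.2) * c p.2 = ∑ i, c i := by
  have := sum_normSq_mul_eq_trace (eigenOverlap hA hB) c 1
  simp only [Pi.one_apply, Complex.ofReal_one, mul_one] at this
  rw [← this, show Matrix.diagonal (fun _ : n => (1 : ℂ)) = 1 from Matrix.diagonal_one,
    Matrix.mul_one, conjTranspose_mul_eigenOverlap_self, Matrix.one_mul]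
  simp [Matrix.trace_diagonal]

lemma trace_re_eq_sum_eigenOverlap [Fintype n] [DecidableEq n] {A B : Matrix n n ℂ}
    (hA : A.IsHermitian) (hB : B.IsHermitian) :
    A.trace.re =
      ∑ p : n × n, Complex.normSq (eigenOverlap hA hB p.1 p.2) * hA.eigenvalues p.2 := by
  rw [sum_normSq_eigenOverlap_mul, hA.trace_eq_sum_eigenvalues]
  simp

lemma relEnt_eq_sum_eigenOverlap [Fintype n] [DecidableEq n] {A B : Matrix n n ℂ}
    (hA : A.IsHermitian) (hB : B.IsHermitian) :
    relEnt A B = ∑ p : n × n, Complex.normSq (eigenOverlap hA hB p.1 p.2) *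
      hA.eigenvalues p.2 *
      (Real.log (hA.eigenvalues p.2) - Real.log (hB.eigenvalues p.1)) := by
  have hAlog : ((A * matLog A).trace).re =
      ∑ i, hA.eigenvalues i * Real.log (hA.eigenvalues i) := by
    rw [matLog, dif_pos hA]
    nth_rw 1 [isHermitian_eq_conj hA]
    have hU := Unitary.coe_star_mul_self hA.eigenvectorUnitary
    rw [Matrix.mul_assoc _ _ (_ * star _), ← Matrix.mul_assoc (star _), ← Matrix.mul_assoc (star _),
      hU, Matrix.one_mul, Matrix.trace_mul_comm, Matrix.mul_assoc, ← Matrix.mul_assoc (star _), hU,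
      Matrix.one_mul, Matrix.diagonal_mul_diagonal, Matrix.trace_diagonal, Complex.re_sum]
    refine Finset.sum_congr rfl fun i _ => ?_
    rw [← Complex.ofReal_mul, Complex.ofReal_re, mul_comm]
  have hBlog := re_trace_conj_mul_conj hA hB hA.eigenvalues
    (fun i => Real.log (hB.eigenvalues i))
  rw [← isHermitian_eq_conj hA] at hBlog
  rw [relEnt, Matrix.mul_sub, Matrix.trace_sub, Complex.sub_re, hAlog, matLog, dif_pos hB, hBlog,
    ← sum_normSq_eigenOverlap_mul hA hB, ← Finset.sum_sub_distrib]
  exact Finset.sum_congr rfl fun p _ => by ring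

/-- The quadratic functional `2 Re⟨X, A⟩ - ⟨X, (L_B + s R_A) X⟩` on matrices with the
Hilbert-Schmidt inner product, where `L_B` and `R_A` are left and right multiplications. -/
noncomputable def modularForm [Fintype n] (s : ℝ) (A B X : Matrix n n ℂ) : ℝ :=
  2 * ((Xᴴ * A).trace).re - ((Xᴴ * B * X).trace).re - s * ((X * A * Xᴴ).trace).re

lemma modularForm_eq_sum [Fintype n] [DecidableEq n] {A B : Matrix n n ℂ}
    (hA : A.IsHermitian) (hB : B.IsHermitian) (s : ℝ) (x : Matrix n n ℂ) :
    modularForm s A B ((hB.eigenvectorUnitary : Matrix n n ℂ) * x *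
      star (hA.eigenvectorUnitary : Matrix n n ℂ)) =
    ∑ p : n × n, (2 * (hA.eigenvalues p.2 *
        (star (x p.1 p.2) * eigenOverlap hA hB p.1 p.2).re) -
      (hB.eigenvalues p.1 + s * hA.eigenvalues p.2) * Complex.normSq (x p.1 p.2)) := by
  set U := (hA.eigenvectorUnitary : Matrix n n ℂ) with hU
  set V := (hB.eigenvectorUnitary : Matrix n n ℂ) with hV
  have hUU : Uᴴ * U = 1 := Unitary.coe_star_mul_self hA.eigenvectorUnitary
  have hVV : Vᴴ * V = 1 := Unitary.coe_star_mul_self hB.eigenvectorUnitary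
  have hUU' : ∀ Y, Uᴴ * (U * Y) = Y := fun Y => by rw [← Matrix.mul_assoc, hUU, Matrix.one_mul]
  have hVV' : ∀ Y, Vᴴ * (V * Y) = Y := fun Y => by rw [← Matrix.mul_assoc, hVV, Matrix.one_mul]
  have eA := isHermitian_eq_conj hA
  have eB := isHermitian_eq_conj hB
  rw [← hU, Matrix.star_eq_conjTranspose] at eA
  rw [← hV, Matrix.star_eq_conjTranspose] at eB
  set a := hA.eigenvalues
  set b := hB.eigenvalues
  have h1 : (((V * x * star U)ᴴ * A).trace).re =
      ∑ p : n × n, a p.2 * (star (x p.1 p.2) * eigenOverlap hA hB p.1 p.2).re := by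
    have : ((V * x * star U)ᴴ * A).trace =
        (xᴴ * eigenOverlap hA hB * Matrix.diagonal (fun i => (a i : ℂ))).trace := by
      conv_lhs => rw [eA]
      rw [eigenOverlap, ← hU, ← hV]
      simp only [Matrix.star_eq_conjTranspose, Matrix.conjTranspose_mul,
        Matrix.conjTranspose_conjTranspose, Matrix.mul_assoc]
      rw [Matrix.trace_mul_comm]
      simp only [Matrix.mul_assoc, hUU, Matrix.mul_one]
    rw [this, Fintype.sum_prod_type, Finset.sum_comm, Matrix.trace, Complex.re_sum]
    refine Finset.sum_congr rfl fun i _ => ?_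
    rw [Matrix.diag_apply, Matrix.mul_diagonal, Matrix.mul_apply, Finset.sum_mul, Complex.re_sum]
    refine Finset.sum_congr rfl fun j _ => ?_
    rw [mul_comm _ (a i : ℂ), Complex.re_ofReal_mul, Matrix.conjTranspose_apply]
  have h2 : (((V * x * star U)ᴴ * B * (V * x * star U)).trace).re =
      ∑ p : n × n, b p.1 * Complex.normSq (x p.1 p.2) := by
    rw [← re_trace_conjTranspose_mul_diagonal_mul, eB]
    simp only [Matrix.star_eq_conjTranspose, Matrix.conjTranspose_mul,
      Matrix.conjTranspose_conjTranspose, Matrix.mul_assoc, hVV']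
    rw [Matrix.trace_mul_comm]
    simp only [Matrix.mul_assoc, hUU, Matrix.mul_one]
  have h3 : (((V * x * star U) * A * (V * x * star U)ᴴ).trace).re =
      ∑ p : n × n, a p.2 * Complex.normSq (x p.1 p.2) := by
    have := re_trace_conjTranspose_mul_diagonal_mul xᴴ a
    rw [Fintype.sum_prod_type, Finset.sum_comm, ← Fintype.sum_prod_type'] at this
    simp only [Matrix.conjTranspose_apply, RCLike.star_def, Complex.normSq_conj,
      Matrix.conjTranspose_conjTranspose] at this
    rw [← this, eA]
    simp only [Matrix.star_eq_conjTranspose, Matrix.conjTranspose_mul,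
      Matrix.conjTranspose_conjTranspose, Matrix.mul_assoc, hUU']
    rw [Matrix.trace_mul_comm]
    simp only [Matrix.mul_assoc, hVV, Matrix.mul_one]
  rw [modularForm, h1, h2, h3]
  simp only [Finset.sum_sub_distrib, add_mul, Finset.sum_add_distrib, Finset.mul_sum, mul_assoc]
  ring

lemma two_mul_re_sub_le {a t : ℝ} (ht : 0 ≤ t) (h0 : t = 0 → a = 0) (x c : ℂ) :
    2 * (a * (star x * c).re) - t * Complex.normSq x ≤ Complex.normSq c * (a ^ 2 / t) := by
  rcases ht.eq_or_lt with h | h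
  · simp [h0 h.symm, ← h]
  · have e : Complex.normSq c * (a ^ 2 / t) -
        (2 * (a * (star x * c).re) - t * Complex.normSq x) =
        ((t * x.re - a * c.re) ^ 2 + (t * x.im - a * c.im) ^ 2) / t := by
      simp only [Complex.normSq_apply, RCLike.star_def, Complex.mul_re, Complex.conj_re,
        Complex.conj_im]
      field_simp
      ring
    have : 0 ≤ ((t * x.re - a * c.re) ^ 2 + (t * x.im - a * c.im) ^ 2) / t := by positivity
    linarith

lemma two_mul_re_sub_eq {a t : ℝ} (h0 : t = 0 → a = 0) (c : ℂ) :
    2 * (a * (star (((a / t : ℝ) : ℂ) * c) * c).re) -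
      t * Complex.normSq (((a / t : ℝ) : ℂ) * c) = Complex.normSq c * (a ^ 2 / t) := by
  by_cases h : t = 0
  · simp [h0 h, h]
  · simp only [Complex.normSq_apply, RCLike.star_def, Complex.mul_re, Complex.conj_re,
      Complex.conj_im, Complex.mul_im, Complex.ofReal_re, Complex.ofReal_im]
    field_simp
    ring

lemma eq_zero_of_add_mul_eq_zero {a b s : ℝ} (ha : 0 ≤ a) (hb : 0 ≤ b) (hs : 0 < s)
    (h : b + s * a = 0) : a = 0 := by
  have : s * a = 0 := by nlinarith [mul_nonneg hs.le ha]
  exact (mul_eq_zero.1 this).resolve_left hs.ne'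

lemma modularForm_le [Fintype n] [DecidableEq n] {A B : Matrix n n ℂ}
    (hA : A.PosSemidef) (hB : B.PosSemidef) {s : ℝ} (hs : 0 < s) (X : Matrix n n ℂ) :
    modularForm s A B X ≤ ∑ p : n × n,
      Complex.normSq (eigenOverlap hA.isHermitian hB.isHermitian p.1 p.2) *
      (hA.isHermitian.eigenvalues p.2 ^ 2 /
        (hB.isHermitian.eigenvalues p.1 + s * hA.isHermitian.eigenvalues p.2)) := by
  have hX : X = (hB.isHermitian.eigenvectorUnitary : Matrix n n ℂ) *
      (star (hB.isHermitian.eigenvectorUnitary : Matrix n n ℂ) * X *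
        (hA.isHermitian.eigenvectorUnitary : Matrix n n ℂ)) *
      star (hA.isHermitian.eigenvectorUnitary : Matrix n n ℂ) := by
    have hU := Unitary.mul_star_self_of_mem hA.isHermitian.eigenvectorUnitary.2
    have hV := Unitary.mul_star_self_of_mem hB.isHermitian.eigenvectorUnitary.2
    rw [Matrix.mul_assoc, Matrix.mul_assoc, hU, Matrix.mul_one, ← Matrix.mul_assoc, hV,
      Matrix.one_mul]
  rw [hX, modularForm_eq_sum]
  refine Finset.sum_le_sum fun p _ => two_mul_re_sub_le ?_ ?_ _ _
  · have := hA.eigenvalues_nonneg p.2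
    have := hB.eigenvalues_nonneg p.1
    positivity
  · exact eq_zero_of_add_mul_eq_zero (hA.eigenvalues_nonneg _) (hB.eigenvalues_nonneg _) hs

lemma exists_modularForm_eq [Fintype n] [DecidableEq n] {A B : Matrix n n ℂ}
    (hA : A.PosSemidef) (hB : B.PosSemidef) {s : ℝ} (hs : 0 < s) :
    ∃ X, modularForm s A B X = ∑ p : n × n,
      Complex.normSq (eigenOverlap hA.isHermitian hB.isHermitian p.1 p.2) *
      (hA.isHermitian.eigenvalues p.2 ^ 2 /
        (hB.isHermitian.eigenvalues p.1 + s * hA.isHermitian.eigenvalues p.2)) := by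
  refine ⟨_, (modularForm_eq_sum hA.isHermitian hB.isHermitian s (Matrix.of fun j i =>
    ((hA.isHermitian.eigenvalues i / (hB.isHermitian.eigenvalues j +
      s * hA.isHermitian.eigenvalues i) : ℝ) : ℂ) *
      eigenOverlap hA.isHermitian hB.isHermitian j i)).trans ?_⟩
  refine Finset.sum_congr rfl fun p _ => ?_
  exact two_mul_re_sub_eq
    (eq_zero_of_add_mul_eq_zero (hA.eigenvalues_nonneg _) (hB.eigenvalues_nonneg _) hs) _

lemma eigenvalue_pos_of_overlap_ne_zero [Fintype n] [DecidableEq n] {A B : Matrix n n ℂ}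
    (hA : A.PosSemidef) (hB : B.PosSemidef) {c : ℝ} (hc : 0 < c)
    (h : (B - (c : ℂ) • A).PosSemidef) (p : n × n)
    (hw : Complex.normSq (eigenOverlap hA.isHermitian hB.isHermitian p.1 p.2) ≠ 0)
    (ha : hA.isHermitian.eigenvalues p.2 ≠ 0) : 0 < hB.isHermitian.eigenvalues p.1 := by
  refine lt_of_le_of_ne (hB.eigenvalues_nonneg _) fun hb => ?_
  set V := (hB.isHermitian.eigenvectorUnitary : Matrix n n ℂ) with hV
  set W := eigenOverlap hA.isHermitian hB.isHermitian with hW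
  have hBd : Vᴴ * B * V = Matrix.diagonal (fun i => (hB.isHermitian.eigenvalues i : ℂ)) := by
    have hVV : Vᴴ * V = 1 := Unitary.coe_star_mul_self hB.isHermitian.eigenvectorUnitary
    have e := isHermitian_eq_conj hB.isHermitian
    rw [← hV, Matrix.star_eq_conjTranspose] at e
    nth_rw 1 [e]
    rw [Matrix.mul_assoc, Matrix.mul_assoc, hVV, Matrix.mul_one, ← Matrix.mul_assoc, hVV,
      Matrix.one_mul]
  have hAd : Vᴴ * A * V =
      W * Matrix.diagonal (fun i => (hA.isHermitian.eigenvalues i : ℂ)) * Wᴴ := by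
    nth_rw 1 [isHermitian_eq_conj hA.isHermitian]
    rw [hW, eigenOverlap, ← hV]
    simp only [Matrix.star_eq_conjTranspose, Matrix.conjTranspose_mul,
      Matrix.conjTranspose_conjTranspose, Matrix.mul_assoc]
  have hd := (h.conjTranspose_mul_mul_same V).diag_nonneg (i := p.1)
  rw [Matrix.mul_sub, Matrix.sub_mul, Matrix.mul_smul, Matrix.smul_mul, hBd, hAd] at hd
  have hre := (Complex.le_def.1 hd).1
  rw [Matrix.sub_apply, Matrix.diagonal_apply_eq, ← hb, Matrix.smul_apply, smul_eq_mul,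
    Complex.sub_re, Complex.re_ofReal_mul, Matrix.mul_apply, Complex.re_sum] at hre
  have hterm : ∀ i, ((W * Matrix.diagonal (fun i => (hA.isHermitian.eigenvalues i : ℂ))) p.1 i *
      Wᴴ i p.1).re = hA.isHermitian.eigenvalues i * Complex.normSq (W p.1 i) := fun i => by
    simp only [Matrix.mul_diagonal, Matrix.conjTranspose_apply, Complex.normSq_apply,
      RCLike.star_def, Complex.mul_re, Complex.mul_im, Complex.conj_re, Complex.conj_im,
      Complex.ofReal_re, Complex.ofReal_im]
    ring
  simp only [hterm, Complex.zero_re, Complex.ofReal_zero, zero_sub, Left.nonneg_neg_iff] at hre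
  have hpos : 0 < ∑ i, hA.isHermitian.eigenvalues i * Complex.normSq (W p.1 i) :=
    Finset.sum_pos' (fun i _ => mul_nonneg (hA.eigenvalues_nonneg i) (Complex.normSq_nonneg _))
      ⟨p.2, Finset.mem_univ _, mul_pos (lt_of_le_of_ne (hA.eigenvalues_nonneg _) ha.symm)
        (lt_of_le_of_ne (Complex.normSq_nonneg _) hw.symm)⟩
  nlinarith [mul_pos hc hpos]

/-- The completely positive map with Kraus operators `K`. -/
def krausMap {κ : Type*} [Fintype κ] [Fintype n] (K : κ → Matrix m n ℂ) (A : Matrix n n ℂ) :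
    Matrix m m ℂ :=
  ∑ i, K i * A * (K i)ᴴ

lemma Matrix.PosSemidef.krausMap {κ : Type*} [Fintype κ] [Fintype n] [Fintype m]
    {A : Matrix n n ℂ} (hA : A.PosSemidef) (K : κ → Matrix m n ℂ) :
    (krausMap K A).PosSemidef :=
  Matrix.posSemidef_sum _ fun i _ => hA.mul_mul_conjTranspose_same (K i)

lemma krausMap_sub {κ : Type*} [Fintype κ] [Fintype n] (K : κ → Matrix m n ℂ)
    (A B : Matrix n n ℂ) : krausMap K (A - B) = krausMap K A - krausMap K B := by
  simp [krausMap, Matrix.mul_sub, Matrix.sub_mul]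

lemma krausMap_smul {κ : Type*} [Fintype κ] [Fintype n] (K : κ → Matrix m n ℂ)
    (c : ℂ) (A : Matrix n n ℂ) : krausMap K (c • A) = c • krausMap K A := by
  simp [krausMap, Finset.smul_sum]

lemma krausMap_sum {κ α : Type*} [Fintype κ] [Fintype α] [Fintype n] (K : κ → Matrix m n ℂ)
    (A : α → Matrix n n ℂ) : krausMap K (∑ j, A j) = ∑ j, krausMap K (A j) := by
  simp only [krausMap, Matrix.mul_sum, Matrix.sum_mul]
  exact Finset.sum_comm

lemma trace_mul_krausMap {κ : Type*} [Fintype κ] [Fintype n] [Fintype m]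
    (K : κ → Matrix m n ℂ) (X : Matrix m m ℂ) (A : Matrix n n ℂ) :
    (X * krausMap K A).trace = (krausMap (fun i => (K i)ᴴ) X * A).trace := by
  simp only [krausMap, Matrix.mul_sum, Matrix.sum_mul, Matrix.trace_sum,
    Matrix.conjTranspose_conjTranspose]
  refine Finset.sum_congr rfl fun i _ => ?_
  rw [← Matrix.mul_assoc, Matrix.trace_mul_comm]
  simp only [Matrix.mul_assoc]

lemma conjTranspose_krausMap {κ : Type*} [Fintype κ] [Fintype n]
    (K : κ → Matrix m n ℂ) (X : Matrix n n ℂ) : (krausMap K X)ᴴ = krausMap K Xᴴ := by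
  simp [krausMap, Matrix.conjTranspose_sum, Matrix.mul_assoc]

lemma trace_krausMap {κ : Type*} [Fintype κ] [Fintype n] [DecidableEq n] [Fintype m]
    {K : κ → Matrix m n ℂ} (hK : ∑ i, (K i)ᴴ * K i = 1) (A : Matrix n n ℂ) :
    (krausMap K A).trace = A.trace := by
  simp only [krausMap, Matrix.trace_sum]
  calc ∑ i, (K i * A * (K i)ᴴ).trace = ∑ i, ((K i)ᴴ * K i * A).trace :=
        Finset.sum_congr rfl fun i _ => by rw [Matrix.trace_mul_comm, Matrix.mul_assoc]
    _ = A.trace := by rw [← Matrix.trace_sum, ← Matrix.sum_mul, hK, Matrix.one_mul]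

/-- A trace form of the Kadison-Schwarz inequality for the dual of a trace-preserving map. -/
lemma re_trace_dual_le {κ : Type*} [Fintype κ] [Fintype n] [DecidableEq n] [Fintype m]
    {K : κ → Matrix m n ℂ} (hK : ∑ i, (K i)ᴴ * K i = 1) {A : Matrix n n ℂ}
    (hA : A.PosSemidef) (X : Matrix m m ℂ) :
    ((krausMap (fun i => (K i)ᴴ) X * A * (krausMap (fun i => (K i)ᴴ) X)ᴴ).trace).re ≤
      ((X * krausMap K A * Xᴴ).trace).re := by
  set Y := krausMap (fun i => (K i)ᴴ) X with hY
  have hnn : 0 ≤ ∑ i, ((X * K i - K i * Y) * A * (X * K i - K i * Y)ᴴ).trace :=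
    Finset.sum_nonneg fun i _ => (hA.mul_mul_conjTranspose_same _).trace_nonneg
  have e1 : ∑ i, (X * K i * A * (X * K i)ᴴ).trace = (X * krausMap K A * Xᴴ).trace := by
    simp only [krausMap, Matrix.mul_sum, Matrix.sum_mul, Matrix.trace_sum,
      Matrix.conjTranspose_mul, Matrix.mul_assoc]
  have e2 : ∑ i, (K i * Y * A * (K i * Y)ᴴ).trace = (Y * A * Yᴴ).trace := by
    rw [← trace_krausMap hK, krausMap, Matrix.trace_sum]
    simp only [Matrix.conjTranspose_mul, Matrix.mul_assoc]
  have e3 : ∑ i, (X * K i * A * (K i * Y)ᴴ).trace = (Y * A * Yᴴ).trace := by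
    calc ∑ i, (X * K i * A * (K i * Y)ᴴ).trace
        = ∑ i, ((K i)ᴴ * X * K i * (A * Yᴴ)).trace := Finset.sum_congr rfl fun i _ => by
          rw [Matrix.conjTranspose_mul, ← Matrix.mul_assoc, Matrix.trace_mul_comm]
          simp only [Matrix.mul_assoc]
      _ = (Y * A * Yᴴ).trace := by
          rw [← Matrix.trace_sum, ← Matrix.sum_mul, hY, krausMap]
          simp only [Matrix.conjTranspose_conjTranspose, Matrix.mul_assoc]
  have e4 : ∑ i, (K i * Y * A * (X * K i)ᴴ).trace = (Y * A * Yᴴ).trace := by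
    have hs : ∀ i, (K i * Y * A * (X * K i)ᴴ).trace =
        star (X * K i * A * (K i * Y)ᴴ).trace := fun i => by
      rw [← Matrix.trace_conjTranspose]
      simp only [Matrix.conjTranspose_mul, Matrix.conjTranspose_conjTranspose,
        hA.isHermitian.eq, Matrix.mul_assoc]
    rw [Finset.sum_congr rfl fun i _ => hs i, ← star_sum, e3, ← Matrix.trace_conjTranspose]
    simp only [Matrix.conjTranspose_mul, Matrix.conjTranspose_conjTranspose,
      hA.isHermitian.eq, Matrix.mul_assoc]
  simp only [Matrix.conjTranspose_sub, Matrix.sub_mul, Matrix.mul_sub, Matrix.trace_sub,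
    Finset.sum_sub_distrib, e1, e2, e3, e4] at hnn
  have := (Complex.le_def.1 hnn).1
  simp only [Complex.zero_re, Complex.sub_re] at this
  linarith

lemma modularForm_krausMap_le {κ : Type*} [Fintype κ] [Fintype n] [DecidableEq n] [Fintype m]
    {K : κ → Matrix m n ℂ} (hK : ∑ i, (K i)ᴴ * K i = 1) {A B : Matrix n n ℂ}
    (hA : A.PosSemidef) (hB : B.PosSemidef) {s : ℝ} (hs : 0 ≤ s) (X : Matrix m m ℂ) :
    modularForm s (krausMap K A) (krausMap K B) X ≤
      modularForm s A B (krausMap (fun i => (K i)ᴴ) X) := by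
  have h1 := re_trace_dual_le hK hA X
  have h2 := re_trace_dual_le hK hB Xᴴ
  rw [Matrix.conjTranspose_conjTranspose, ← conjTranspose_krausMap,
    Matrix.conjTranspose_conjTranspose] at h2
  rw [modularForm, modularForm, trace_mul_krausMap, conjTranspose_krausMap,
    ← conjTranspose_krausMap]
  nlinarith [mul_le_mul_of_nonneg_left h1 hs]

/-- Monotonicity of the relative entropy under trace-preserving completely positive maps, for
arguments with `c A ≤ B` for some `c > 0`. -/
lemma relEnt_krausMap_le {κ : Type*} [Fintype κ] [Fintype n] [DecidableEq n] [Fintype m]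
    [DecidableEq m] {K : κ → Matrix m n ℂ} (hK : ∑ i, (K i)ᴴ * K i = 1) {A B : Matrix n n ℂ}
    (hA : A.PosSemidef) (hB : B.PosSemidef) {c : ℝ} (hc : 0 < c)
    (h : (B - (c : ℂ) • A).PosSemidef) :
    relEnt (krausMap K A) (krausMap K B) ≤ relEnt A B := by
  have hA' := hA.krausMap K
  have hB' := hB.krausMap K
  have h' := h.krausMap K
  rw [krausMap_sub, krausMap_smul] at h'
  rw [relEnt_eq_sum_eigenOverlap hA.isHermitian hB.isHermitian,
    relEnt_eq_sum_eigenOverlap hA'.isHermitian hB'.isHermitian]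
  refine sum_mul_log_sub_le_of_resolvent_le
    (fun p : n × n => Complex.normSq (eigenOverlap hA.isHermitian hB.isHermitian p.1 p.2))
    (fun p => hA.isHermitian.eigenvalues p.2) (fun p => hB.isHermitian.eigenvalues p.1)
    (fun p : m × m => Complex.normSq (eigenOverlap hA'.isHermitian hB'.isHermitian p.1 p.2))
    (fun p => hA'.isHermitian.eigenvalues p.2) (fun p => hB'.isHermitian.eigenvalues p.1)
    (fun _ => hA.eigenvalues_nonneg _) (fun _ => hB.eigenvalues_nonneg _)
    (eigenvalue_pos_of_overlap_ne_zero hA hB hc h)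
    (fun _ => hA'.eigenvalues_nonneg _) (fun _ => hB'.eigenvalues_nonneg _)
    (eigenvalue_pos_of_overlap_ne_zero hA' hB' hc h') ?_ fun s hs => ?_
  · rw [← trace_re_eq_sum_eigenOverlap, ← trace_re_eq_sum_eigenOverlap, trace_krausMap hK]
  · obtain ⟨X, hX⟩ := exists_modularForm_eq hA' hB' hs
    rw [← hX]
    exact (modularForm_krausMap_le hK hA hB hs.le X).trans (modularForm_le hA hB hs _)

lemma matLog_diagonal [Fintype n] [DecidableEq n] (p : n → ℝ) :
    matLog (Matrix.diagonal fun i => (p i : ℂ)) =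
      Matrix.diagonal fun i => (Real.log (p i) : ℂ) := by
  have h : (Matrix.diagonal fun i => (p i : ℂ)).IsHermitian :=
    Matrix.isHermitian_diagonal_of_self_adjoint _ (by ext i; simp)
  rw [matLog, dif_pos h]
  set U := (h.eigenvectorUnitary : Matrix n n ℂ) with hU
  have hUU : star U * U = 1 := Unitary.coe_star_mul_self h.eigenvectorUnitary
  have hUU' : U * star U = 1 := Unitary.coe_mul_star_self h.eigenvectorUnitary
  have hcomm : (Matrix.diagonal fun i => (p i : ℂ)) * U =
      U * Matrix.diagonal fun i => (h.eigenvalues i : ℂ) := by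
    conv_lhs => rw [isHermitian_eq_conj h]
    rw [← hU, Matrix.mul_assoc, hUU, Matrix.mul_one]
  have hlog : (U * Matrix.diagonal fun i => (Real.log (h.eigenvalues i) : ℂ)) =
      (Matrix.diagonal fun i => (Real.log (p i) : ℂ)) * U := by
    ext i j
    have e := congrFun (congrFun hcomm i) j
    simp only [Matrix.diagonal_mul, Matrix.mul_diagonal] at e ⊢
    by_cases hz : U i j = 0
    · simp [hz]
    · rw [mul_comm] at e
      have e' : p i = h.eigenvalues j := by exact_mod_cast mul_left_cancel₀ hz e
      rw [e', mul_comm]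
  rw [hlog, Matrix.mul_assoc, hUU', Matrix.mul_one]

lemma relEnt_diagonal [Fintype n] [DecidableEq n] (p q : n → ℝ) :
    relEnt (Matrix.diagonal fun i => (p i : ℂ)) (Matrix.diagonal fun i => (q i : ℂ)) =
      ∑ i, p i * (Real.log (p i) - Real.log (q i)) := by
  rw [relEnt, matLog_diagonal, matLog_diagonal, Matrix.diagonal_sub,
    Matrix.diagonal_mul_diagonal, Matrix.trace_diagonal, Complex.re_sum]
  refine Finset.sum_congr rfl fun i _ => ?_
  rw [← Complex.ofReal_sub, ← Complex.ofReal_mul, Complex.ofReal_re]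

/-- Kraus operators of the measurement `τ ↦ diag (Tr (E i τ E i))`. -/
def measureKraus {ι : Type*} [DecidableEq ι] (E : ι → Matrix m m ℂ) (q : ι × m) :
    Matrix ι m ℂ :=
  Matrix.of fun i b => if i = q.1 then E q.1 q.2 b else 0

lemma sum_measureKraus {ι : Type*} [Fintype ι] [DecidableEq ι] [Fintype m] [DecidableEq m]
    {E : ι → Matrix m m ℂ} (hE : OrthRes E) :
    ∑ q, (measureKraus E q)ᴴ * measureKraus E q = 1 := by
  rw [← hE.2.2.2, Fintype.sum_prod_type]
  refine Finset.sum_congr rfl fun i _ => ?_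
  rw [show E i = (E i)ᴴ * E i by rw [(hE.1 i).eq, hE.2.1 i]]
  ext b c
  simp [Matrix.sum_apply, Matrix.mul_apply, measureKraus, apply_ite]

lemma krausMap_measureKraus {ι : Type*} [Fintype ι] [DecidableEq ι] [Fintype m] [DecidableEq m]
    {E : ι → Matrix m m ℂ} (hE : OrthRes E) {A : Matrix m m ℂ} (hA : A.PosSemidef) :
    krausMap (measureKraus E) A = Matrix.diagonal fun i => ((((A * E i).trace).re : ℝ) : ℂ) := by
  have htr : ∀ i, ((((A * E i).trace).re : ℝ) : ℂ) = (E i * A * (E i)ᴴ).trace := fun i => by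
    have e : (A * E i).trace = (E i * A * (E i)ᴴ).trace := by
      rw [(hE.1 i).eq, Matrix.trace_mul_comm (E i * A), ← Matrix.mul_assoc, hE.2.1 i,
        Matrix.trace_mul_comm]
    rw [e]
    have := (Complex.le_def.1 (hA.mul_mul_conjTranspose_same (E i)).trace_nonneg).2
    exact Complex.ext (by simp) (by simpa using this)
  simp only [htr]
  ext i j
  rw [krausMap, Matrix.sum_apply, Fintype.sum_prod_type]
  by_cases hij : i = j
  · subst hij
    rw [Matrix.diagonal_apply_eq, Finset.sum_eq_single i]
    · simp [Matrix.trace, Matrix.mul_apply, measureKraus]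
    · intro k _ hk
      simp [Matrix.mul_apply, measureKraus, hk.symm]
    · simp
  · rw [Matrix.diagonal_apply_ne _ hij]
    refine Finset.sum_eq_zero fun k _ => Finset.sum_eq_zero fun a _ => ?_
    by_cases hk : i = k
    · have : j ≠ k := fun h => hij (hk.trans h.symm)
      simp [Matrix.mul_apply, measureKraus, this]
    · simp [Matrix.mul_apply, measureKraus, hk]

lemma trace_pinching_mul {ι : Type*} [Fintype ι] [Fintype m] [DecidableEq m]
    {E : ι → Matrix m m ℂ} (hE : OrthRes E) (A : Matrix m m ℂ) (i : ι) :
    ((∑ j, E j * A * E j) * E i).trace = (A * E i).trace := by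
  rw [Matrix.sum_mul, Finset.sum_eq_single i]
  · rw [Matrix.mul_assoc, hE.2.1 i, Matrix.mul_assoc, Matrix.trace_mul_comm, Matrix.mul_assoc,
      hE.2.1 i]
  · intro j _ hj
    rw [Matrix.mul_assoc, hE.2.2.1 j i hj, Matrix.mul_zero]
  · simp

lemma posSemidef_sum_sub_smul {κ : Type*} [Fintype κ] [Fintype n] {lam : κ → ℝ}
    {σs : κ → Matrix n n ℂ} (hlam : ∀ k, 0 ≤ lam k) (hσs : ∀ k, (σs k).PosSemidef) (k : κ) :
    (∑ j, (lam j : ℂ) • σs j - (lam k : ℂ) • σs k).PosSemidef := by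
  classical
  rw [← Finset.add_sum_erase _ _ (Finset.mem_univ k), add_sub_cancel_left]
  exact Matrix.posSemidef_sum _ fun j _ => (hσs j).smul (by exact_mod_cast hlam j)

/-- The Holevo quantity of a finite ensemble decreases under trace-preserving completely positive
maps. -/
lemma sum_mul_relEnt_krausMap_le {κ α : Type*} [Fintype κ] [Fintype α] [Fintype n]
    [DecidableEq n] [Fintype m] [DecidableEq m] {K : α → Matrix m n ℂ}
    (hK : ∑ i, (K i)ᴴ * K i = 1) {lam : κ → ℝ} {σs : κ → Matrix n n ℂ}
    (hlam : ∀ k, 0 ≤ lam k) (hσs : ∀ k, (σs k).PosSemidef) :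
    ∑ k, lam k * relEnt (krausMap K (σs k)) (krausMap K (∑ j, (lam j : ℂ) • σs j)) ≤
      ∑ k, lam k * relEnt (σs k) (∑ j, (lam j : ℂ) • σs j) := by
  refine Finset.sum_le_sum fun k _ => ?_
  rcases (hlam k).eq_or_lt with h | h
  · simp [← h]
  · exact mul_le_mul_of_nonneg_left (relEnt_krausMap_le hK (hσs k)
      (Matrix.posSemidef_sum _ fun j _ => (hσs j).smul (by exact_mod_cast hlam j)) h
      (posSemidef_sum_sub_smul hlam hσs k)) h.le

/-- Two-sided bound on the mutual entropy for a channel `Γ* = Γ₁* ∘ Γ₂*` with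
`Γ₁*` a pinching. -/
theorem stmt11_two_sided_bound {ι κ : Type*} [Fintype ι] [Fintype κ]
    [Fintype n] [DecidableEq n] [Fintype m] [DecidableEq m]
    (lam : κ → ℝ) (σs : κ → Matrix n n ℂ) (σ : Matrix n n ℂ)
    (hlam : ∀ k, 0 ≤ lam k) (hsum : ∑ k, lam k = 1)
    (hσs : ∀ k, IsDensity (σs k)) (hσ : σ = ∑ k, (lam k : ℂ) • σs k)
    (Γ₂ : Matrix n n ℂ → Matrix m m ℂ) (hΓ₂ : IsCPTP Γ₂)
    (E : ι → Matrix m m ℂ) (hE : OrthRes E)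
    (Γ : Matrix n n ℂ → Matrix m m ℂ)
    (hΓ : ∀ τ, Γ τ = ∑ i, E i * Γ₂ τ * E i) :
    (∑ i, (-(((Γ₂ σ * E i).trace).re * Real.log ((Γ₂ σ * E i).trace).re) +
        ∑ k, lam k * (((Γ₂ (σs k) * E i).trace).re *
          Real.log ((Γ₂ (σs k) * E i).trace).re))
      ≤ ∑ k, lam k * relEnt (Γ (σs k)) (Γ σ)) ∧
    ∑ k, lam k * relEnt (Γ (σs k)) (Γ σ) ≤ ∑ k, lam k * relEnt (σs k) σ := by
  classical
  obtain ⟨α, _, K, hK, hK1⟩ := hΓ₂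
  set L : ι × α → Matrix m n ℂ := fun p => E p.1 * K p.2 with hL
  have hL1 : ∑ p, (L p)ᴴ * L p = 1 := by
    rw [Fintype.sum_prod_type, Finset.sum_comm, ← hK1]
    refine Finset.sum_congr rfl fun a _ => ?_
    calc ∑ i, (L (i, a))ᴴ * L (i, a) = ∑ i, (K a)ᴴ * E i * K a :=
          Finset.sum_congr rfl fun i _ => by
            rw [hL, Matrix.conjTranspose_mul, (hE.1 i).eq, Matrix.mul_assoc,
              ← Matrix.mul_assoc (E i), hE.2.1 i, Matrix.mul_assoc]
      _ = (K a)ᴴ * K a := by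
          rw [← Matrix.sum_mul, ← Matrix.mul_sum, hE.2.2.2, Matrix.mul_one]
  have hΓL : ∀ τ, Γ τ = krausMap L τ := fun τ => by
    rw [hΓ, hK, krausMap, Fintype.sum_prod_type]
    refine Finset.sum_congr rfl fun i _ => ?_
    simp only [hL, Matrix.mul_sum, Matrix.sum_mul, Matrix.conjTranspose_mul, (hE.1 i).eq,
      Matrix.mul_assoc]
  have hpos : ∀ k, (σs k).PosSemidef := fun k => (hσs k).1
  have hσpos : σ.PosSemidef := hσ ▸
    Matrix.posSemidef_sum _ fun j _ => (hpos j).smul (by exact_mod_cast hlam j)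
  have hΓσ : Γ σ = ∑ k, (lam k : ℂ) • Γ (σs k) := by
    simp only [hΓL, hσ, krausMap_sum, krausMap_smul]
  have hΓpos : ∀ τ : Matrix n n ℂ, τ.PosSemidef → (Γ τ).PosSemidef := fun τ hτ =>
    hΓL τ ▸ hτ.krausMap L
  constructor
  · have hmeas : ∀ τ : Matrix n n ℂ, τ.PosSemidef → krausMap (measureKraus E) (Γ τ) =
        Matrix.diagonal fun i => ((((Γ₂ τ * E i).trace).re : ℝ) : ℂ) := fun τ hτ => by
      rw [krausMap_measureKraus hE (hΓpos τ hτ), hΓ]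
      simp only [trace_pinching_mul hE]
    have hle := sum_mul_relEnt_krausMap_le (sum_measureKraus hE) hlam
      (fun k => hΓpos _ (hpos k))
    rw [← hΓσ, hmeas σ hσpos] at hle
    simp only [hmeas _ (hpos _), relEnt_diagonal] at hle
    refine le_of_eq_of_le ?_ hle
    have hq : ∀ i, ((Γ₂ σ * E i).trace).re = ∑ k, lam k * ((Γ₂ (σs k) * E i).trace).re :=
      fun i => by
        rw [← trace_pinching_mul hE, ← hΓ, hΓσ, Matrix.sum_mul, Matrix.trace_sum, Complex.re_sum]
        refine Finset.sum_congr rfl fun k _ => ?_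
        rw [Matrix.smul_mul, Matrix.trace_smul, smul_eq_mul, Complex.re_ofReal_mul, hΓ,
          trace_pinching_mul hE]
    simp only [Finset.mul_sum]
    rw [Finset.sum_comm]
    refine Finset.sum_congr rfl fun i _ => ?_
    simp only [mul_sub, Finset.sum_sub_distrib]
    nth_rw 1 [hq i]
    simp only [Finset.sum_mul, mul_assoc]
    ring
  · simp only [hΓL, hσ]
    exact sum_mul_relEnt_krausMap_le hL1 hlam hpos
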